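/- There exist infinitely many odd integers a > 3 such that 4a² + 1 is square-free, and there exist infinitely many odd integers a > 3 such that a² − 4 is square-free. -/

import Mathlib

lemma aux_dvd {p : ℕ} (hp : p.Prime) (hp2 : p ≠ 2) {u v a b : ℤ} (huv : u * v ∣ 4)
    (ha : (p : ℤ) ^ 2 ∣ u * a ^ 2 + v) (hb : (p : ℤ) ^ 2 ∣ u * b ^ 2 + v) :
    (p : ℤ) ^ 2 ∣ a - b ∨ (p : ℤ) ^ 2 ∣ a + b := by
  have hpi : Prime (p : ℤ) := Nat.prime_iff_prime_int.mp hp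
  have h2 : ¬ (p : ℤ) ∣ 2 := fun h => by
    have h' : p ∣ 2 := by exact_mod_cast h
    exact hp2 ((Nat.prime_dvd_prime_iff_eq hp Nat.prime_two).mp h')
  have h4 : ¬ (p : ℤ) ∣ 4 := fun h => by
    have h' : (p : ℤ) ∣ 2 * 2 := by simpa using h
    rcases hpi.dvd_or_dvd h' with h | h <;> exact h2 h
  have hu : ¬ (p : ℤ) ∣ u := fun h => h4 ((h.mul_right v).trans huv)
  have hv : ¬ (p : ℤ) ∣ v := fun h => h4 ((h.mul_left u).trans huv)
  have hna : ¬ (p : ℤ) ∣ a := fun h => by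
    have h1 : (p : ℤ) ∣ u * a ^ 2 + v := (dvd_pow_self _ two_ne_zero).trans ha
    have h3 : (p : ℤ) ∣ u * a ^ 2 := (dvd_pow h two_ne_zero).mul_left u
    exact hv ((dvd_add_right h3).mp h1)
  have hcop : ∀ x : ℤ, ¬ (p : ℤ) ∣ x → IsCoprime ((p : ℤ) ^ 2) x := fun x hx =>
    (((Prime.coprime_iff_not_dvd hpi).mpr hx)).pow_left
  have hprod : (p : ℤ) ^ 2 ∣ u * ((a - b) * (a + b)) := by
    have := dvd_sub ha hb
    have e : u * a ^ 2 + v - (u * b ^ 2 + v) = u * ((a - b) * (a + b)) := by ring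
    rwa [e] at this
  have hprod := (hcop u hu).dvd_of_dvd_mul_left hprod
  by_cases h1 : (p : ℤ) ∣ a - b
  · have h3 : ¬ (p : ℤ) ∣ a + b := fun h => by
      have h5 := dvd_add h1 h
      have e : a - b + (a + b) = 2 * a := by ring
      rw [e] at h5
      rcases hpi.dvd_or_dvd h5 with h | h
      · exact h2 h
      · exact hna h
    exact Or.inl ((hcop _ h3).dvd_of_dvd_mul_right hprod)
  · exact Or.inr ((hcop _ h1).dvd_of_dvd_mul_left hprod)

lemma aux_class (r M v : ℕ) (hr : 0 < r) :
    (((Finset.range M).filter (fun m => m ≡ v [MOD r])).card : ℝ) ≤ (M : ℝ) / r + 1 := by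
  rw [← Nat.count_eq_card_filter_range, Nat.count_modEq_card _ hr]
  have h : ((M / r : ℕ) : ℝ) ≤ (M : ℝ) / r := Nat.cast_div_le
  split_ifs <;> push_cast <;> linarith

lemma aux_count {p : ℕ} (hp : p.Prime) (hp2 : p ≠ 2) {u v : ℤ} (huv : u * v ∣ 4) (M : ℕ) :
    (((Finset.range M).filter
      (fun m : ℕ => (p : ℤ) ^ 2 ∣ u * (2 * (m : ℤ) + 1) ^ 2 + v)).card : ℝ)
      ≤ 2 * ((M : ℝ) * (1 / (p : ℝ) ^ 2)) + 2 := by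
  set S := (Finset.range M).filter
      (fun m : ℕ => (p : ℤ) ^ 2 ∣ u * (2 * (m : ℤ) + 1) ^ 2 + v) with hS
  rcases S.eq_empty_or_nonempty with h | ⟨m0, hm0⟩
  · rw [h]; simp; positivity
  have hr : 0 < p ^ 2 := pow_pos hp.pos 2
  have hm0' := (Finset.mem_filter.mp hm0).2
  have h2 : IsCoprime ((p : ℤ) ^ 2) 2 := by
    apply IsCoprime.pow_left
    rw [Prime.coprime_iff_not_dvd (Nat.prime_iff_prime_int.mp hp)]
    intro h
    have h' : p ∣ 2 := by exact_mod_cast h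
    exact hp2 ((Nat.prime_dvd_prime_iff_eq hp Nat.prime_two).mp h')
  obtain ⟨w, hw⟩ : ∃ w : ℕ, p ^ 2 ∣ w + m0 + 1 := by
    refine ⟨(p ^ 2 - 1) * (m0 + 1), m0 + 1, ?_⟩
    obtain ⟨q, hq⟩ := Nat.exists_eq_add_of_lt hr
    rw [hq]; simp; ring
  have hsub : S ⊆ (Finset.range M).filter (fun m => m ≡ m0 [MOD p ^ 2]) ∪
      (Finset.range M).filter (fun m => m ≡ w [MOD p ^ 2]) := by
    intro m hm
    have hm' := Finset.mem_filter.mp hm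
    rw [Finset.mem_union, Finset.mem_filter, Finset.mem_filter]
    rcases aux_dvd hp hp2 huv hm'.2 hm0' with h | h
    · left
      refine ⟨hm'.1, ?_⟩
      have e : (2 * (m : ℤ) + 1) - (2 * m0 + 1) = 2 * (m - m0) := by ring
      rw [e] at h
      have h := h2.dvd_of_dvd_mul_left h
      refine (Nat.modEq_iff_dvd.mpr ?_).symm
      exact_mod_cast h
    · right
      refine ⟨hm'.1, ?_⟩
      have e : (2 * (m : ℤ) + 1) + (2 * m0 + 1) = 2 * (m + m0 + 1) := by ring
      rw [e] at h
      have h := h2.dvd_of_dvd_mul_left h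
      have hw' : (p : ℤ) ^ 2 ∣ w + m0 + 1 := by exact_mod_cast hw
      refine (Nat.modEq_iff_dvd.mpr ?_).symm
      have := dvd_sub h hw'
      have e : (m : ℤ) + m0 + 1 - (w + m0 + 1) = m - w := by ring
      rw [e] at this
      exact_mod_cast this
  have hc := (Nat.cast_le (α := ℝ)).mpr
    ((Finset.card_le_card hsub).trans (Finset.card_union_le _ _))
  have h1 := aux_class (p ^ 2) M m0 hr
  have h3 := aux_class (p ^ 2) M w hr
  push_cast at hc h1 h3
  rw [← div_eq_mul_one_div]
  linarith

lemma aux_tele (n : ℕ) :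
    ∑ k ∈ Finset.range n, 1 / (((2 * k + 3 : ℕ) : ℝ)) ^ 2 ≤ 1 / 4 - 1 / (4 * ((n : ℝ) + 1)) := by
  induction n with
  | zero => norm_num
  | succ n ih =>
    rw [Finset.sum_range_succ]
    have : 1 / (((2 * n + 3 : ℕ) : ℝ)) ^ 2
        ≤ 1 / (4 * ((n : ℝ) + 1)) - 1 / (4 * (((n + 1 : ℕ) : ℝ) + 1)) := by
      push_cast
      have e : 1 / (4 * ((n : ℝ) + 1)) - 1 / (4 * ((n : ℝ) + 1 + 1))
          = 1 / (4 * ((n : ℝ) + 1) * (n + 2)) := by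
        field_simp; ring
      rw [e]
      apply one_div_le_one_div_of_le (by positivity)
      nlinarith
    linarith

lemma aux_sum (N : ℕ) :
    ∑ p ∈ (Nat.primesLE N).filter (· ≠ 2), 1 / (p : ℝ) ^ 2 ≤ 1 / 4 := by
  have hsub : (Nat.primesLE N).filter (· ≠ 2) ⊆ (Finset.range N).image (fun k => 2 * k + 3) := by
    intro p hp
    rw [Finset.mem_filter, Nat.mem_primesLE] at hp
    obtain ⟨⟨hpN, hp⟩, hp2⟩ := hp
    have := hp.two_le
    have := hp.eq_two_or_odd
    rw [Finset.mem_image]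
    refine ⟨(p - 3) / 2, ?_, ?_⟩
    · rw [Finset.mem_range]; omega
    · omega
  refine (Finset.sum_le_sum_of_subset_of_nonneg hsub (fun _ _ _ => by positivity)).trans ?_
  rw [Finset.sum_image (fun a _ b _ h => by simpa using h)]
  have := aux_tele N
  have h : 0 ≤ 1 / (4 * ((N : ℝ) + 1)) := by positivity
  linarith

lemma aux_pi : ∃ M0 : ℕ, ∀ M : ℕ, M0 ≤ M → (Nat.primeCounting (4 * M) : ℝ) ≤ (M : ℝ) / 8 := by
  have h := Chebyshev.eventually_primeCounting_le one_pos
  have hl := Real.tendsto_log_atTop.eventually_ge_atTop (32 * (Real.log 4 + 1))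
  obtain ⟨B, hB⟩ := Filter.eventually_atTop.mp (h.and (hl.and (Filter.eventually_gt_atTop 1)))
  refine ⟨⌈B⌉₊, fun M hM => ?_⟩
  have hM' : B ≤ M := (Nat.le_ceil B).trans (by exact_mod_cast hM)
  have hBM : B ≤ ((4 * M : ℕ) : ℝ) := by
    push_cast
    have : (0 : ℝ) ≤ M := by positivity
    linarith
  obtain ⟨h1, h2, h3⟩ := hB _ hBM
  rw [Nat.floor_natCast] at h1
  refine h1.trans ?_
  rw [div_le_iff₀ (Real.log_pos h3)]
  have : (0 : ℝ) ≤ M := by positivity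
  have := mul_le_mul_of_nonneg_left h2 this
  push_cast at *
  linarith

lemma aux_main {u v : ℤ} (huv : u * v ∣ 4)
    (hodd : ∀ m : ℕ, Odd (u * (2 * (m : ℤ) + 1) ^ 2 + v))
    (hb : ∀ m : ℕ, |u * (2 * (m : ℤ) + 1) ^ 2 + v| ≤ 4 * (2 * (m : ℤ) + 1) ^ 2 + 1) :
    {m : ℕ | Squarefree (u * (2 * (m : ℤ) + 1) ^ 2 + v)}.Infinite := by
  classical
  intro hfin
  obtain ⟨M0, hM0⟩ := aux_pi
  set G := hfin.toFinset with hG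
  set M := M0 + 4 * G.card + 1 with hM
  have hcov : Finset.range M ⊆ G ∪ ((Nat.primesLE (4 * M)).filter (· ≠ 2)).biUnion
      (fun p => (Finset.range M).filter
        (fun m : ℕ => (p : ℤ) ^ 2 ∣ u * (2 * (m : ℤ) + 1) ^ 2 + v)) := by
    intro m hm
    rw [Finset.mem_union]
    by_cases hs : Squarefree (u * (2 * (m : ℤ) + 1) ^ 2 + v)
    · left; rw [hG, Set.Finite.mem_toFinset]; exact hs
    · right
      rw [← Int.squarefree_natAbs, Nat.squarefree_iff_prime_squarefree] at hs
      push Not at hs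
      obtain ⟨p, hp, hpd⟩ := hs
      have hpd' : (p : ℤ) ^ 2 ∣ u * (2 * (m : ℤ) + 1) ^ 2 + v := by
        rw [← Int.natCast_dvd] at hpd
        rw [pow_two]; exact_mod_cast hpd
      rw [Finset.mem_biUnion]
      refine ⟨p, ?_, Finset.mem_filter.mpr ⟨hm, hpd'⟩⟩
      rw [Finset.mem_filter, Nat.mem_primesLE]
      refine ⟨⟨?_, hp⟩, ?_⟩
      · have hne : u * (2 * (m : ℤ) + 1) ^ 2 + v ≠ 0 := fun h => by
          have := hodd m
          rw [h] at this
          exact absurd this (by decide)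
        have h1 := Int.le_of_dvd (abs_pos.mpr hne) ((dvd_abs _ _).mpr hpd')
        have h2 := h1.trans (hb m)
        have h3 : m < M := Finset.mem_range.mp hm
        by_contra! hlt
        have h4 : 4 * (m : ℤ) + 3 ≤ p := by omega
        nlinarith
      · rintro rfl
        have h1 : (2 : ℤ) ∣ u * (2 * (m : ℤ) + 1) ^ 2 + v :=
          Dvd.dvd.trans (by norm_num) hpd'
        exact (Int.not_even_iff_odd.mpr (hodd m)) (even_iff_two_dvd.mpr h1)
  have hc := (Finset.card_le_card hcov).trans
    ((Finset.card_union_le _ _).trans (Nat.add_le_add_left Finset.card_biUnion_le _))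
  rw [Finset.card_range] at hc
  have hc' : (M : ℝ) ≤ G.card + ∑ p ∈ (Nat.primesLE (4 * M)).filter (· ≠ 2),
      (((Finset.range M).filter
        (fun m : ℕ => (p : ℤ) ^ 2 ∣ u * (2 * (m : ℤ) + 1) ^ 2 + v)).card : ℝ) := by
    exact_mod_cast hc
  have hsum : ∑ p ∈ (Nat.primesLE (4 * M)).filter (· ≠ 2),
      (((Finset.range M).filter
        (fun m : ℕ => (p : ℤ) ^ 2 ∣ u * (2 * (m : ℤ) + 1) ^ 2 + v)).card : ℝ)
      ≤ ∑ p ∈ (Nat.primesLE (4 * M)).filter (· ≠ 2),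
        (2 * ((M : ℝ) * (1 / (p : ℝ) ^ 2)) + 2) := by
    apply Finset.sum_le_sum
    intro p hp
    rw [Finset.mem_filter, Nat.mem_primesLE] at hp
    exact aux_count hp.1.2 hp.2 huv M
  rw [Finset.sum_add_distrib, ← Finset.mul_sum, ← Finset.mul_sum, Finset.sum_const,
    nsmul_eq_mul] at hsum
  have hs := mul_le_mul_of_nonneg_left (aux_sum (4 * M)) (Nat.cast_nonneg (α := ℝ) M)
  have hcard : ((((Nat.primesLE (4 * M)).filter (· ≠ 2)).card : ℕ) : ℝ) ≤ (M : ℝ) / 8 := by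
    refine le_trans ?_ (hM0 M (by omega))
    rw [← Nat.primesLE_card_eq_primeCounting]
    exact_mod_cast Finset.card_filter_le _ _
  have hMr : (M : ℝ) = M0 + 4 * G.card + 1 := by rw [hM]; push_cast; ring
  have : (0 : ℝ) ≤ M0 := by positivity
  linarith

lemma aux_transfer {u v : ℤ}
    (h : {m : ℕ | Squarefree (u * (2 * (m : ℤ) + 1) ^ 2 + v)}.Infinite) :
    {a : ℤ | Odd a ∧ 3 < a ∧ Squarefree (u * a ^ 2 + v)}.Infinite := by
  have h' := h.sdiff (Set.finite_Iic 1)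
  have hinj : Function.Injective (fun m : ℕ => 2 * (m : ℤ) + 1) := by
    intro a b hab
    simp only at hab
    omega
  refine (h'.image hinj.injOn).mono ?_
  rintro _ ⟨m, ⟨hm, hm1⟩, rfl⟩
  simp only [Set.mem_Iic, not_le] at hm1
  exact ⟨⟨m, rfl⟩, by simp only; omega, hm⟩

/-- There are infinitely many odd integers `a > 3` with `4a² + 1` squarefree, and
infinitely many odd integers `a > 3` with `a² − 4` squarefree. -/
theorem infinitely_many_squarefree_values :
    {a : ℤ | Odd a ∧ 3 < a ∧ Squarefree (4 * a ^ 2 + 1)}.Infinite ∧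
    {a : ℤ | Odd a ∧ 3 < a ∧ Squarefree (a ^ 2 - 4)}.Infinite := by
  constructor
  · apply aux_transfer
    apply aux_main
    · norm_num
    · intro m
      exact ⟨2 * (2 * (m : ℤ) + 1) ^ 2, by ring⟩
    · intro m
      rw [abs_of_pos (by positivity)]
  · have h : {a : ℤ | Odd a ∧ 3 < a ∧ Squarefree (1 * a ^ 2 + (-4))}.Infinite := by
      apply aux_transfer
      apply aux_main
      · norm_num
      · intro m
        exact ⟨2 * (m : ℤ) ^ 2 + 2 * m - 2, by ring⟩
      · intro m
        have : (0 : ℤ) ≤ m := by positivity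
        rw [abs_le]
        constructor <;> nlinarith
    simpa [sub_eq_add_neg] using h
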